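/- Fix N ≥ 1 and a link pattern β = {{a_1,b_1},…,{a_N,b_N}} ∈ LP_N with links ordered as usual, so that a_1 = 1 and b_1 = 2ℓ for some ℓ ∈ {1,…,N}. Then for all x = (x_1,…,x_{2N}) ∈ 𝔛_{2N}: 8·(∂F_β/∂x_1)(x)/F_β(x) − 1/(x_{2ℓ}−x_1) = A(x)/B(x), where A(x) := ∑_{σ̂ ∈ {±1}^{N−1}} ( − ∑_{r=2}^{N} σ̂_r · (x_{b_r}−x_{a_r}) / ((x_{a_r}−x_1)(x_{b_r}−x_1)) ) · ∏_{s=2}^{N} χ(x_1, x_{a_s}, x_{b_s}, x_{2ℓ})^{(σ̂_s+1)/4} · ∏_{2≤r<s≤N} χ(x_{a_r}, x_{a_s}, x_{b_s}, x_{b_r})^{(σ̂_r σ̂_s + 1)/4}, and B(x) := ∑_{σ̂ ∈ {±1}^{N−1}} ∏_{s=2}^{N} χ(x_1, x_{a_s}, x_{b_s}, x_{2ℓ})^{(σ̂_s+1)/4} · ∏_{2≤r<s≤N} χ(x_{a_r}, x_{a_s}, x_{b_s}, x_{b_r})^{(σ̂_r σ̂_s + 1)/4}, the tuples σ̂ =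 (σ̂_2,…,σ̂_N) running over {±1}^{N−1}. -/

import Mathlib

open Filter Topology

noncomputable section

/-- The cross-ratio `χ(y₁,y₂,y₃,y₄)` of four reals. -/
def crossRatioR (y₁ y₂ y₃ y₄ : ℝ) : ℝ :=
  (|y₂ - y₁| * |y₄ - y₃|) / (|y₃ - y₁| * |y₄ - y₂|)

/-- The sign `±1` associated to a boolean. -/
def sgn (s : Bool) : ℝ := if s then 1 else -1

/-- `a b : Fin N → Fin (2*N)` encode a planar link pattern `β ∈ LP_N`:
the pairs (links) `{a r, b r}` partition `{0, …, 2N-1}`, the link endpoints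
are ordered so that `a` is strictly increasing and `a r < b r` for every link,
and the links are non-crossing. -/
def IsLinkPattern (N : ℕ) (a b : Fin N → Fin (2 * N)) : Prop :=
  Function.Bijective (fun p : Fin N × Bool => if p.2 then a p.1 else b p.1) ∧
    StrictMono a ∧ (∀ r, a r < b r) ∧
    ¬∃ r s : Fin N, a r < a s ∧ a s < b r ∧ b r < b s

/-- The function `F_β` associated to the link pattern `β` encoded by `a, b`. -/
def Fbeta (N : ℕ) (a b : Fin N → Fin (2 * N)) (x : Fin (2 * N) → ℝ) : ℝ :=
  (∏ r : Fin N, |x (b r) - x (a r)| ^ (-(1 / 8) : ℝ)) *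
    (∑ σ : Fin N → Bool, ∏ s : Fin N, ∏ t : Fin N,
        if s < t then
          crossRatioR (x (a s)) (x (a t)) (x (b t)) (x (b s)) ^ (sgn (σ s) * sgn (σ t) / 4)
        else 1) ^ ((1 : ℝ) / 2)

/-- The chamber `𝔛_n = {x ∈ ℝⁿ : x₀ < x₁ < ⋯ < x_{n-1}}`. -/
def chamber (n : ℕ) : Set (Fin n → ℝ) := {x | StrictMono x}

/-- Partial derivative of `F` in the `i`-th coordinate at `x`. -/
def pd (n : ℕ) (F : (Fin n → ℝ) → ℝ) (i : Fin n) (x : Fin n → ℝ) : ℝ :=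
  deriv (fun t => F (Function.update x i t)) (x i)

/-- The order-preserving map `{0,…,N-2} → {1,…,N-1}` (i.e. `{2,…,N}` in 1-indexing). -/
def liftIdx (N : ℕ) (i : Fin (N - 1)) : Fin N := ⟨i.val + 1, by have := i.isLt; omega⟩

/-- The weight `∏_{s<t} e_{st}^{σ_s σ_t / 4}` of a spin configuration `σ` with couplings `e`. -/
def spinWeight {n : ℕ} (e : Fin n → Fin n → ℝ) (σ : Fin n → Bool) : ℝ :=
  ∏ s : Fin n, ∏ t : Fin n, if s < t then e s t ^ (sgn (σ s) * sgn (σ t) / 4) else 1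

lemma sgn_not (s : Bool) : sgn (!s) = -sgn s := by
  cases s <;> simp [sgn]

lemma spinWeight_cons {n : ℕ} (e : Fin (n + 1) → Fin (n + 1) → ℝ) (s : Bool) (σ : Fin n → Bool) :
    spinWeight e (Fin.cons s σ) =
      (∏ t : Fin n, e 0 t.succ ^ (sgn s * sgn (σ t) / 4)) *
        spinWeight (fun r t => e r.succ t.succ) σ := by
  simp [spinWeight, Fin.prod_univ_succ]

lemma spinWeight_not {n : ℕ} (e : Fin n → Fin n → ℝ) (σ : Fin n → Bool) :
    spinWeight e (fun s => !σ s) = spinWeight e σ := by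
  simp [spinWeight, sgn_not]

lemma sum_spinWeight_succ {n : ℕ} (e : Fin (n + 1) → Fin (n + 1) → ℝ) :
    ∑ σ : Fin (n + 1) → Bool, spinWeight e σ =
      2 * ∑ σ : Fin n → Bool, (∏ t : Fin n, e 0 t.succ ^ (sgn (σ t) / 4)) *
        spinWeight (fun r t => e r.succ t.succ) σ := by
  rw [← (Fin.consEquiv fun _ : Fin (n + 1) => Bool).sum_comp, Fintype.sum_prod_type,
    Fintype.sum_bool, two_mul]
  congr 1
  · refine Finset.sum_congr rfl fun σ _ => ?_
    refine (spinWeight_cons e true σ).trans ?_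
    simp [sgn]
  · refine Fintype.sum_equiv (Equiv.piCongrRight fun _ => Equiv.boolNot) _ _ fun σ => ?_
    refine (spinWeight_cons e false σ).trans ?_
    have h := spinWeight_not (fun r t => e (Fin.succ r) (Fin.succ t)) σ
    change _ = (∏ t : Fin n, e 0 t.succ ^ (sgn (!σ t) / 4)) *
      spinWeight (fun r t => e r.succ t.succ) (fun t => !σ t)
    rw [h]
    simp [sgn_not, show sgn false = -1 from rfl]

lemma spinWeight_pos {n : ℕ} {e : Fin n → Fin n → ℝ} (he : ∀ s t, s < t → 0 < e s t)
    (σ : Fin n → Bool) : 0 < spinWeight e σ := by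
  refine Finset.prod_pos fun s _ => Finset.prod_pos fun t _ => ?_
  split_ifs with h
  · exact Real.rpow_pos_of_pos (he s t h) _
  · exact one_pos

lemma prod_rpow_add_one_div_four {n : ℕ} {e : Fin n → Fin n → ℝ}
    (he : ∀ s t, s < t → 0 < e s t) (σ : Fin n → Bool) :
    (∏ s : Fin n, ∏ t : Fin n,
        if s < t then e s t ^ ((sgn (σ s) * sgn (σ t) + 1) / 4) else 1) =
      spinWeight e σ *
        ∏ s : Fin n, ∏ t : Fin n, if s < t then e s t ^ ((1 : ℝ) / 4) else 1 := by
  simp only [spinWeight, ← Finset.prod_mul_distrib]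
  refine Finset.prod_congr rfl fun s _ => Finset.prod_congr rfl fun t _ => ?_
  split_ifs with h
  · rw [add_div, Real.rpow_add (he s t h)]
  · simp

lemma crossRatioR_pos {y₁ y₂ y₃ y₄ : ℝ} (h₁₂ : y₂ ≠ y₁) (h₃₄ : y₄ ≠ y₃) (h₁₃ : y₃ ≠ y₁)
    (h₂₄ : y₄ ≠ y₂) : 0 < crossRatioR y₁ y₂ y₃ y₄ := by
  have := abs_pos.2 (sub_ne_zero.2 h₁₂)
  have := abs_pos.2 (sub_ne_zero.2 h₃₄)
  have := abs_pos.2 (sub_ne_zero.2 h₁₃)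
  have := abs_pos.2 (sub_ne_zero.2 h₂₄)
  unfold crossRatioR
  positivity

lemma hasDerivAt_abs_sub {u t : ℝ} (h : u ≠ t) :
    HasDerivAt (fun y => |u - y|) (|u - t| * (-1 / (u - t))) t := by
  have h' : u - t ≠ 0 := sub_ne_zero.2 h
  refine ((hasDerivAt_abs h').comp t ((hasDerivAt_id t).const_sub u)).congr_deriv ?_
  rcases h'.lt_or_gt with hlt | hgt
  · rw [abs_of_neg hlt, sign_neg hlt]
    field_simp
    simp
  · rw [abs_of_pos hgt, sign_pos hgt]
    field_simp
    simp

lemma hasDerivAt_rpow_of_log_deriv {f : ℝ → ℝ} {t l : ℝ} (hf : HasDerivAt f (f t * l) t)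
    (h : 0 < f t) (p : ℝ) : HasDerivAt (fun y => f y ^ p) (f t ^ p * (p * l)) t := by
  refine (hf.rpow_const (p := p) (Or.inl h.ne')).congr_deriv ?_
  rw [Real.rpow_sub_one h.ne']
  field_simp

lemma hasDerivAt_prod_of_log_deriv {ι : Type*} (S : Finset ι) {f : ι → ℝ → ℝ} {l : ι → ℝ} {t : ℝ}
    (hf : ∀ i ∈ S, HasDerivAt (f i) (f i t * l i) t) :
    HasDerivAt (fun y => ∏ i ∈ S, f i y) ((∏ i ∈ S, f i t) * ∑ i ∈ S, l i) t := by
  classical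
  induction S using Finset.induction_on with
  | empty => simpa using hasDerivAt_const t (1 : ℝ)
  | insert i S hi ih =>
    simp only [Finset.prod_insert hi, Finset.sum_insert hi]
    refine ((hf i (Finset.mem_insert_self i S)).mul
      (ih fun j hj => hf j (Finset.mem_insert_of_mem hj))).congr_deriv ?_
    ring

lemma hasDerivAt_crossRatioR {y₁ y₂ y₃ y₄ : ℝ} (h₁₂ : y₂ ≠ y₁) (h₁₃ : y₃ ≠ y₁) :
    HasDerivAt (fun y => crossRatioR y y₂ y₃ y₄)
      (crossRatioR y₁ y₂ y₃ y₄ * -((y₃ - y₂) / ((y₂ - y₁) * (y₃ - y₁)))) y₁ := by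
  have h₂ : y₂ - y₁ ≠ 0 := sub_ne_zero.2 h₁₂
  have h₃ : y₃ - y₁ ≠ 0 := sub_ne_zero.2 h₁₃
  have := abs_ne_zero.2 h₃
  simp only [crossRatioR, mul_div_mul_comm]
  refine (((hasDerivAt_abs_sub h₁₂).fun_div (hasDerivAt_abs_sub h₁₃)
    (abs_ne_zero.2 h₃)).mul_const (|y₄ - y₃| / |y₄ - y₂|)).congr_deriv ?_
  field_simp
  ring

/-- The derivative of a spin sum whose couplings `c s` have logarithmic derivatives `l s`. -/
lemma hasDerivAt_spin_sum {n : ℕ} {c : Fin n → ℝ → ℝ} {l : Fin n → ℝ} {t : ℝ}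
    (w : (Fin n → Bool) → ℝ) (hc : ∀ s, 0 < c s t)
    (hd : ∀ s, HasDerivAt (c s) (c s t * l s) t) :
    HasDerivAt (fun y => ∑ σ : Fin n → Bool, (∏ s, c s y ^ (sgn (σ s) / 4)) * w σ)
      (∑ σ : Fin n → Bool, (∏ s, c s t ^ (sgn (σ s) / 4)) * (∑ s, sgn (σ s) / 4 * l s) * w σ) t :=
  HasDerivAt.fun_sum fun σ _ => (hasDerivAt_prod_of_log_deriv Finset.univ
    fun s _ => hasDerivAt_rpow_of_log_deriv (hd s) (hc s) (sgn (σ s) / 4)).mul_const (w σ)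

lemma IsLinkPattern.ne {N : ℕ} {a b : Fin N → Fin (2 * N)} (h : IsLinkPattern N a b) :
    (∀ r s, r ≠ s → a r ≠ a s) ∧ (∀ r s, r ≠ s → b r ≠ b s) ∧ ∀ r s, a r ≠ b s := by
  refine ⟨fun r s hrs e => hrs ?_, fun r s hrs e => hrs ?_, fun r s e => ?_⟩
  · simpa using h.1.injective (a₁ := (r, true)) (a₂ := (s, true)) (by simpa using e)
  · simpa using h.1.injective (a₁ := (r, false)) (a₂ := (s, false)) (by simpa using e)
  · simpa using h.1.injective (a₁ := (r, true)) (a₂ := (s, false)) (by simpa using e)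

lemma Fbeta_update {n : ℕ} {a b : Fin (n + 1) → Fin (2 * (n + 1))}
    (hβ : IsLinkPattern (n + 1) a b) (x : Fin (2 * (n + 1)) → ℝ) (t : ℝ) :
    Fbeta (n + 1) a b (Function.update x (a 0) t) =
      |x (b 0) - t| ^ (-(1 / 8) : ℝ) *
        (∏ r : Fin n, |x (b r.succ) - x (a r.succ)| ^ (-(1 / 8) : ℝ)) *
        (2 * ∑ σ : Fin n → Bool,
          (∏ s : Fin n, crossRatioR t (x (a s.succ)) (x (b s.succ)) (x (b 0)) ^ (sgn (σ s) / 4)) *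
          spinWeight (fun r s => crossRatioR (x (a r.succ)) (x (a s.succ)) (x (b s.succ))
            (x (b r.succ))) σ) ^ ((1 : ℝ) / 2) := by
  obtain ⟨ha, -, hab⟩ := hβ.ne
  have ha' (r : Fin n) : a r.succ ≠ a 0 := ha _ _ (Fin.succ_ne_zero r)
  have hb' (r : Fin (n + 1)) : b r ≠ a 0 := (hab 0 r).symm
  have key := sum_spinWeight_succ fun s t' : Fin (n + 1) =>
    crossRatioR (Function.update x (a 0) t (a s)) (Function.update x (a 0) t (a t'))
      (Function.update x (a 0) t (b t')) (Function.update x (a 0) t (b s))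
  simp only [Function.update_self, Function.update_of_ne (ha' _), Function.update_of_ne (hb' _)]
    at key
  rw [← key, Fbeta, Fin.prod_univ_succ]
  simp only [Function.update_self, Function.update_of_ne (ha' _), Function.update_of_ne (hb' _),
    spinWeight]

lemma Fbeta_log_deriv_succ {n : ℕ} {a b : Fin (n + 1) → Fin (2 * (n + 1))}
    (hβ : IsLinkPattern (n + 1) a b) {x : Fin (2 * (n + 1)) → ℝ} (hx : Function.Injective x)
    {i : Fin (2 * (n + 1))} (hi : a 0 = i) :
    8 * pd (2 * (n + 1)) (Fbeta (n + 1) a b) i x / Fbeta (n + 1) a b x - 1 / (x (b 0) - x i) =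
      (∑ σ : Fin n → Bool,
          (-(∑ r : Fin n, sgn (σ r) * (x (b r.succ) - x (a r.succ)) /
                ((x (a r.succ) - x i) * (x (b r.succ) - x i)))) *
            (∏ s : Fin n, crossRatioR (x i) (x (a s.succ)) (x (b s.succ)) (x (b 0)) ^
              ((sgn (σ s) + 1) / 4)) *
            ∏ r : Fin n, ∏ s : Fin n,
              if r < s then
                crossRatioR (x (a r.succ)) (x (a s.succ)) (x (b s.succ)) (x (b r.succ)) ^
                  ((sgn (σ r) * sgn (σ s) + 1) / 4)
              else 1) /
        ∑ σ : Fin n → Bool,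
          (∏ s : Fin n, crossRatioR (x i) (x (a s.succ)) (x (b s.succ)) (x (b 0)) ^
              ((sgn (σ s) + 1) / 4)) *
            ∏ r : Fin n, ∏ s : Fin n,
              if r < s then
                crossRatioR (x (a r.succ)) (x (a s.succ)) (x (b s.succ)) (x (b r.succ)) ^
                  ((sgn (σ r) * sgn (σ s) + 1) / 4)
              else 1 := by
  subst hi
  obtain ⟨ha, hb, hab⟩ := hβ.ne
  have hs (r : Fin n) : r.succ ≠ 0 := Fin.succ_ne_zero r
  set c : Fin n → ℝ → ℝ := fun s y => crossRatioR y (x (a s.succ)) (x (b s.succ)) (x (b 0))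
  set d : Fin n → Fin n → ℝ := fun r s =>
    crossRatioR (x (a r.succ)) (x (a s.succ)) (x (b s.succ)) (x (b r.succ))
  set l : Fin n → ℝ := fun s => -((x (b s.succ) - x (a s.succ)) /
    ((x (a s.succ) - x (a 0)) * (x (b s.succ) - x (a 0)))) with hl_def
  have hc (s : Fin n) : 0 < c s (x (a 0)) :=
    crossRatioR_pos (hx.ne (ha _ _ (hs s))) (hx.ne (hb _ _ (hs s).symm)) (hx.ne (hab _ _).symm)
      (hx.ne (hab _ _).symm)
  have hd (r s : Fin n) (hrs : r < s) : 0 < d r s := by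
    have hrs' : r.succ ≠ s.succ := (Fin.succ_injective n).ne hrs.ne
    exact crossRatioR_pos (hx.ne (ha _ _ hrs'.symm)) (hx.ne (hb _ _ hrs')) (hx.ne (hab _ _).symm)
      (hx.ne (hab _ _).symm)
  have hcd (s : Fin n) : HasDerivAt (c s) (c s (x (a 0)) * l s) (x (a 0)) :=
    hasDerivAt_crossRatioR (hx.ne (ha _ _ (hs s))) (hx.ne (hab _ _).symm)
  set S : ℝ → ℝ := fun y =>
    ∑ σ : Fin n → Bool, (∏ s, c s y ^ (sgn (σ s) / 4)) * spinWeight d σ with hS_def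
  set S' : ℝ := ∑ σ : Fin n → Bool, (∏ s, c s (x (a 0)) ^ (sgn (σ s) / 4)) *
    (∑ s, sgn (σ s) / 4 * l s) * spinWeight d σ with hS'_def
  have hSd : HasDerivAt S S' (x (a 0)) := hasDerivAt_spin_sum (spinWeight d) hc hcd
  have hS : 0 < S (x (a 0)) := Finset.sum_pos (fun σ _ => mul_pos
    (Finset.prod_pos fun s _ => Real.rpow_pos_of_pos (hc s) _) (spinWeight_pos hd σ))
    Finset.univ_nonempty
  set K : ℝ := ∏ r : Fin n, |x (b r.succ) - x (a r.succ)| ^ (-(1 / 8) : ℝ)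
  have hK : 0 < K := Finset.prod_pos fun r _ =>
    Real.rpow_pos_of_pos (abs_pos.2 (sub_ne_zero.2 (hx.ne (hab _ _).symm))) _
  have hu : x (b 0) ≠ x (a 0) := hx.ne (hab _ _).symm
  have hF (t : ℝ) : Fbeta (n + 1) a b (Function.update x (a 0) t) =
      |x (b 0) - t| ^ (-(1 / 8) : ℝ) * K * (2 * S t) ^ ((1 : ℝ) / 2) := Fbeta_update hβ x t
  have hFx : Fbeta (n + 1) a b x =
      |x (b 0) - x (a 0)| ^ (-(1 / 8) : ℝ) * K * (2 * S (x (a 0))) ^ ((1 : ℝ) / 2) := by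
    rw [← hF, Function.update_eq_self]
  have hu' : 0 < |x (b 0) - x (a 0)| := abs_pos.2 (sub_ne_zero.2 hu)
  have hFpos : 0 < Fbeta (n + 1) a b x := by
    rw [hFx]
    positivity
  have h2S : HasDerivAt (fun y => 2 * S y) (2 * S (x (a 0)) * (S' / S (x (a 0)))) (x (a 0)) := by
    refine (hSd.const_mul 2).congr_deriv ?_
    field_simp
  have hderiv : pd (2 * (n + 1)) (Fbeta (n + 1) a b) (a 0) x =
      Fbeta (n + 1) a b x * (1 / 8 * (1 / (x (b 0) - x (a 0))) + 1 / 2 * (S' / S (x (a 0)))) := by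
    unfold pd
    simp only [hF]
    rw [hFx]
    refine HasDerivAt.deriv (HasDerivAt.congr_deriv (((hasDerivAt_rpow_of_log_deriv (hasDerivAt_abs_sub hu) hu' (-(1 / 8))).mul_const K).mul
      (hasDerivAt_rpow_of_log_deriv h2S (by positivity) (1 / 2))) ?_)
    ring
  set M : ℝ := (∏ s, c s (x (a 0)) ^ ((1 : ℝ) / 4)) *
    ∏ r : Fin n, ∏ s : Fin n, if r < s then d r s ^ ((1 : ℝ) / 4) else 1
  have hM : 0 < M := by
    refine mul_pos (Finset.prod_pos fun s _ => Real.rpow_pos_of_pos (hc s) _)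
      (Finset.prod_pos fun r _ => Finset.prod_pos fun s _ => ?_)
    split_ifs with h
    · exact Real.rpow_pos_of_pos (hd r s h) _
    · exact one_pos
  have hweight (σ : Fin n → Bool) :
      (∏ s, c s (x (a 0)) ^ ((sgn (σ s) + 1) / 4)) * (∏ r : Fin n, ∏ s : Fin n,
        if r < s then d r s ^ ((sgn (σ r) * sgn (σ s) + 1) / 4) else 1) =
      (∏ s, c s (x (a 0)) ^ (sgn (σ s) / 4)) * spinWeight d σ * M := by
    rw [prod_rpow_add_one_div_four hd]
    simp only [add_div, Real.rpow_add (hc _), Finset.prod_mul_distrib]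
    ring
  have hnum : (∑ σ : Fin n → Bool,
      (-(∑ r : Fin n, sgn (σ r) * (x (b r.succ) - x (a r.succ)) /
        ((x (a r.succ) - x (a 0)) * (x (b r.succ) - x (a 0))))) *
      (∏ s, c s (x (a 0)) ^ ((sgn (σ s) + 1) / 4)) * (∏ r : Fin n, ∏ s : Fin n,
        if r < s then d r s ^ ((sgn (σ r) * sgn (σ s) + 1) / 4) else 1)) = 4 * S' * M := by
    rw [hS'_def, Finset.mul_sum, Finset.sum_mul]
    refine Finset.sum_congr rfl fun σ _ => ?_
    have hsum : -(∑ r : Fin n, sgn (σ r) * (x (b r.succ) - x (a r.succ)) /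
        ((x (a r.succ) - x (a 0)) * (x (b r.succ) - x (a 0)))) =
        4 * ∑ s, sgn (σ s) / 4 * l s := by
      rw [Finset.mul_sum, ← Finset.sum_neg_distrib]
      refine Finset.sum_congr rfl fun s _ => ?_
      rw [hl_def]
      ring
    rw [mul_assoc, hweight, hsum]
    ring
  have hden : (∑ σ : Fin n → Bool,
      (∏ s, c s (x (a 0)) ^ ((sgn (σ s) + 1) / 4)) * (∏ r : Fin n, ∏ s : Fin n,
        if r < s then d r s ^ ((sgn (σ r) * sgn (σ s) + 1) / 4) else 1)) = S (x (a 0)) * M := by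
    simp only [hweight]
    rw [hS_def, Finset.sum_mul]
  refine Eq.trans ?_ (congrArg₂ (· / ·) hnum hden).symm
  rw [hderiv, mul_div_mul_right _ _ hM.ne', mul_div_assoc, mul_div_cancel_left₀ _ hFpos.ne']
  ring

/-- the logarithmic derivative identity
`8 ∂₁F_β(x)/F_β(x) − 1/(x_{2ℓ}−x₁) = A(x)/B(x)`, where `{1, 2ℓ}` is the link of `β`
containing `1` (in `0`-indexing: the link `{a ⟨0⟩, b ⟨0⟩}` with `a ⟨0⟩ = 0`). -/
theorem Fbeta_log_deriv (N : ℕ) (hN : 1 ≤ N) (a b : Fin N → Fin (2 * N))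
    (hβ : IsLinkPattern N a b)
    (h1 : (a ⟨0, by omega⟩).val = 0)
    (x : Fin (2 * N) → ℝ) (hx : StrictMono x) :
    8 * pd (2 * N) (Fbeta N a b) ⟨0, by omega⟩ x / Fbeta N a b x
        - 1 / (x (b ⟨0, by omega⟩) - x ⟨0, by omega⟩)
      =
      (∑ σ : Fin (N - 1) → Bool,
          (-(∑ r : Fin (N - 1),
                sgn (σ r) * (x (b (liftIdx N r)) - x (a (liftIdx N r)))
                  / ((x (a (liftIdx N r)) - x ⟨0, by omega⟩)
                      * (x (b (liftIdx N r)) - x ⟨0, by omega⟩))))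
            * (∏ s : Fin (N - 1),
                crossRatioR (x ⟨0, by omega⟩) (x (a (liftIdx N s))) (x (b (liftIdx N s)))
                    (x (b ⟨0, by omega⟩)) ^ ((sgn (σ s) + 1) / 4))
            * ∏ r : Fin (N - 1), ∏ s : Fin (N - 1),
                if r < s then
                  crossRatioR (x (a (liftIdx N r))) (x (a (liftIdx N s)))
                      (x (b (liftIdx N s))) (x (b (liftIdx N r)))
                    ^ ((sgn (σ r) * sgn (σ s) + 1) / 4)
                else 1)
        /
        (∑ σ : Fin (N - 1) → Bool,
          (∏ s : Fin (N - 1),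
              crossRatioR (x ⟨0, by omega⟩) (x (a (liftIdx N s))) (x (b (liftIdx N s)))
                  (x (b ⟨0, by omega⟩)) ^ ((sgn (σ s) + 1) / 4))
            * ∏ r : Fin (N - 1), ∏ s : Fin (N - 1),
                if r < s then
                  crossRatioR (x (a (liftIdx N r))) (x (a (liftIdx N s)))
                      (x (b (liftIdx N s))) (x (b (liftIdx N r)))
                    ^ ((sgn (σ r) * sgn (σ s) + 1) / 4)
                else 1) := by
  obtain ⟨n, rfl⟩ := Nat.exists_eq_add_of_le' hN
  exact Fbeta_log_deriv_succ hβ hx.injective (Fin.ext h1)
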